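/- Let h_1, ..., h_N be nonzero linear functionals on ℝ^d and a_1, ..., a_N real numbers, and let A be the hyperplane arrangement consisting of the affine hyperplanes H_i = {x ∈ ℝ^d : h_i(x) = a_i}. Suppose the a_i are generic in the sense that every central subset I ⊆ {1,...,N} satisfies rk(I) = |I|; here a subset I is central if ⋂_{i∈I} H_i ≠ ∅ and rk(I) is the dimension of the linear span of {h_i : i ∈ I}. Then the number of regions of A equals the number of subsets I ⊆ {1,...,N} with rk(I) = |I|. -/

import Mathlib

/-- The number of regions of the complement of an arrangement. -/
noncomputable def numRegions {V : Type*} [TopologicalSpace V] (s : Set V) : ℕ :=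
  Nat.card (ConnectedComponents s)

/-- The rank of a subset `I` of the hyperplanes: the dimension of the linear span of
the corresponding linear functionals. -/
noncomputable def rk {d N : ℕ} (h : Fin N → ((Fin d → ℝ) →ₗ[ℝ] ℝ))
    (I : Finset (Fin N)) : ℕ :=
  Module.finrank ℝ (Submodule.span ℝ (h '' ↑I))

/-- A subset `I` is central if the intersection of the corresponding hyperplanes is
nonempty. -/
def IsCentral {d N : ℕ} (h : Fin N → ((Fin d → ℝ) →ₗ[ℝ] ℝ)) (a : Fin N → ℝ)
    (I : Finset (Fin N)) : Prop :=
  (⋂ i ∈ I, {x : Fin d → ℝ | h i x = a i}).Nonempty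

open Finset in
/-- A family which contains, for every `I ∈ 𝒯`, all the sets agreeing off `I` with some fixed
set has at least as many members as `𝒯`. -/
lemma card_le_card_of_forall_exists_cube_subset {α : Type*} [Fintype α] [DecidableEq α]
    (𝒜 𝒯 : Finset (Finset α))
    (hcube : ∀ I ∈ 𝒯, ∃ t : Finset α, ∀ u : Finset α, (∀ i ∉ I, i ∈ u ↔ i ∈ t) → u ∈ 𝒜) :
    #𝒯 ≤ #𝒜 := by
  have hdisj : Disjoint (𝒯.image compl) 𝒜ᶜ.shatterer := by
    rw [Finset.disjoint_left]
    intro J hJ hshat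
    obtain ⟨I, hI, rfl⟩ := Finset.mem_image.1 hJ
    obtain ⟨t, ht⟩ := hcube I hI
    obtain ⟨u, hu, hut⟩ := mem_shatterer.1 hshat (t := Iᶜ ∩ t) inter_subset_left
    refine Finset.mem_compl.1 hu (ht u fun i hi ↦ ?_)
    have := Finset.ext_iff.1 hut i
    simpa [hi] using this
  have h₁ : #(𝒯.image compl) = #𝒯 := card_image_of_injective _ compl_injective
  have h₂ := card_le_univ (𝒯.image compl ∪ 𝒜ᶜ.shatterer)
  rw [card_union_of_disjoint hdisj, h₁] at h₂
  have h₃ := card_le_card_shatterer 𝒜ᶜ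
  have h₄ := card_add_card_compl 𝒜
  omega

/-- If a locally constant function has preconnected fibres, then its values correspond to the
connected components of its domain. -/
lemma IsLocallyConstant.card_connectedComponents {X Y : Type*} [TopologicalSpace X] {f : X → Y}
    (hf : IsLocallyConstant f) (hpre : ∀ x, IsPreconnected {y | f y = f x}) :
    Nat.card (ConnectedComponents X) = Nat.card (Set.range f) := by
  have hker : connectedComponentSetoid X = Setoid.ker f := by
    ext x y
    change connectedComponent x = connectedComponent y ↔ f x = f y
    constructor
    · intro hxy
      exact hf.apply_eq_of_isPreconnected isPreconnected_connectedComponent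
        mem_connectedComponent (hxy ▸ mem_connectedComponent)
    · intro hxy
      exact (connectedComponent_eq ((hpre y).subset_connectedComponent rfl hxy)).symm
  unfold ConnectedComponents
  rw [hker]
  exact Nat.card_congr (Setoid.quotientKerEquivRange f)

/-- Linearly independent functionals can be prescribed arbitrary values. -/
lemma LinearIndependent.exists_forall_apply_eq {K V ι : Type*} [Field K] [AddCommGroup V]
    [Module K V] [Fintype ι] {f : ι → V →ₗ[K] K} (hf : LinearIndependent K f) (t : ι → K) :
    ∃ v, ∀ i, f i v = t i := by
  classical
  have hsurj : Function.Surjective (LinearMap.pi f) := by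
    rw [← LinearMap.dualMap_injective_iff, injective_iff_map_eq_zero]
    intro φ hφ
    have hsum : ∑ i, φ (Pi.single i 1) • f i = 0 := by
      ext v
      have := LinearMap.congr_fun hφ v
      rw [LinearMap.dualMap_apply, LinearMap.pi_apply_eq_sum_univ] at this
      have hsingle (i : ι) : (fun j ↦ if i = j then (1 : K) else 0) = Pi.single i 1 := by
        ext j
        simp [Pi.single_apply, eq_comm]
      simpa [mul_comm, hsingle] using this
    have hzero := Fintype.linearIndependent_iff.1 hf _ hsum
    ext i
    simpa using hzero i
  obtain ⟨v, hv⟩ := hsurj t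
  exact ⟨v, fun i ↦ congr_fun hv i⟩

section Arrangement

variable {d N : ℕ} {h : Fin N → ((Fin d → ℝ) →ₗ[ℝ] ℝ)} {a : Fin N → ℝ}

lemma rk_eq_card_iff {I : Finset (Fin N)} :
    rk h I = I.card ↔ LinearIndependent ℝ (fun i : I ↦ h i) := by
  rw [linearIndependent_iff_card_eq_finrank_span, rk, Set.finrank, Fintype.card_coe, eq_comm,
    Set.image_eq_range]
  rfl

/-- The set of hyperplanes having `x` on their positive side. -/
noncomputable def positiveSide (h : Fin N → ((Fin d → ℝ) →ₗ[ℝ] ℝ)) (a : Fin N → ℝ)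
    (x : Fin d → ℝ) : Finset (Fin N) :=
  {i | a i < h i x}

lemma mem_positiveSide {x : Fin d → ℝ} {i : Fin N} : i ∈ positiveSide h a x ↔ a i < h i x := by
  simp [positiveSide]

/-- The sign patterns realized by the points of the complement of an arrangement. -/
noncomputable def signPatterns (h : Fin N → ((Fin d → ℝ) →ₗ[ℝ] ℝ)) (a : Fin N → ℝ) :
    Finset (Finset (Fin N)) :=
  (Set.toFinite (positiveSide h a '' {x | ∀ i, h i x ≠ a i})).toFinset

lemma mem_signPatterns {u : Finset (Fin N)} :
    u ∈ signPatterns h a ↔ ∃ x, (∀ i, h i x ≠ a i) ∧ positiveSide h a x = u := by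
  simp [signPatterns]

lemma isLocallyConstant_positiveSide :
    IsLocallyConstant fun x : {x : Fin d → ℝ | ∀ i, h i x ≠ a i} ↦ positiveSide h a x := by
  rw [IsLocallyConstant.iff_eventually_eq]
  intro x
  have hside : ∀ i, ∀ᶠ y : {x : Fin d → ℝ | ∀ i, h i x ≠ a i} in nhds x,
      (a i < h i y ↔ a i < h i x) := by
    intro i
    have hcont : ContinuousAt (fun y : {x : Fin d → ℝ | ∀ i, h i x ≠ a i} ↦ h i y) x :=
      ((h i).continuous_of_finiteDimensional.comp continuous_subtype_val).continuousAt
    rcases lt_or_gt_of_ne (x.2 i) with hlt | hgt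
    · filter_upwards [hcont.eventually (gt_mem_nhds hlt)] with y hy
      exact iff_of_false hy.not_gt hlt.not_gt
    · filter_upwards [hcont.eventually (lt_mem_nhds hgt)] with y hy
      exact iff_of_true hy hgt
  filter_upwards [Filter.eventually_all.2 hside] with y hy
  ext i
  simpa only [mem_positiveSide] using hy i

lemma isPreconnected_positiveSide_fiber (x : {x : Fin d → ℝ | ∀ i, h i x ≠ a i}) :
    IsPreconnected {y : {x : Fin d → ℝ | ∀ i, h i x ≠ a i} |
      positiveSide h a y = positiveSide h a x} := by
  rw [← Topology.IsInducing.subtypeVal.isPreconnected_image]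
  have himage : Subtype.val '' {y : {x : Fin d → ℝ | ∀ i, h i x ≠ a i} |
      positiveSide h a y = positiveSide h a x} =
      ⋂ i, if a i < h i x then {y | a i < h i y} else {y | h i y < a i} := by
    ext y
    simp only [Set.mem_image, Set.mem_ofPred_eq, Subtype.exists, exists_and_right, exists_eq_right,
      Set.mem_iInter, Finset.ext_iff, mem_positiveSide]
    constructor
    · rintro ⟨hy, hxy⟩ i
      split_ifs with hi
      · exact (hxy i).2 hi
      · exact lt_of_le_of_ne (not_lt.1 (mt (hxy i).1 hi)) (hy i)
    · intro hy
      refine ⟨fun i ↦ ?_, fun i ↦ ?_⟩ <;> specialize hy i <;> split_ifs at hy with hi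
      · exact ne_of_gt hy
      · exact ne_of_lt hy
      · exact iff_of_true hy hi
      · exact iff_of_false (lt_asymm hy) hi
  rw [himage]
  refine (convex_iInter fun i ↦ ?_).isPreconnected
  split_ifs
  · exact convex_halfSpace_gt (h i).isLinear _
  · exact convex_halfSpace_lt (h i).isLinear _

lemma numRegions_eq_card_signPatterns :
    numRegions {x : Fin d → ℝ | ∀ i, h i x ≠ a i} = (signPatterns h a).card := by
  rw [numRegions, isLocallyConstant_positiveSide.card_connectedComponents
    isPreconnected_positiveSide_fiber, signPatterns,
    ← Nat.card_eq_card_finite_toFinset, Set.image_eq_range]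

lemma linearIndependent_of_shatters {I : Finset (Fin N)} (hI : (signPatterns h a).Shatters I) :
    LinearIndependent ℝ (fun i : I ↦ h i) := by
  rw [Fintype.linearIndependent_iff]
  intro c hc
  by_contra! hne
  have hsum (x : Fin d → ℝ) : ∑ i, c i * (h i x - a i) = -∑ i, c i * a i := by
    have := LinearMap.congr_fun hc x
    simp only [LinearMap.sum_apply, LinearMap.smul_apply, smul_eq_mul,
      LinearMap.zero_apply] at this
    rw [← zero_sub, ← this, ← Finset.sum_sub_distrib]
    simp only [mul_sub]
  have hpos (c' : I → ℝ) (hne' : ∃ i, c' i ≠ 0) : ∃ x, 0 < ∑ i, c' i * (h i x - a i) := by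
    obtain ⟨u, hu, hut⟩ := hI (t := Finset.image Subtype.val {i : I | 0 < c' i}) (by
      intro i
      simp +contextual)
    obtain ⟨x, hx, rfl⟩ := mem_signPatterns.1 hu
    have hside (i : I) : a i < h i x ↔ 0 < c' i := by
      have := Finset.ext_iff.1 hut i
      simpa [mem_positiveSide] using this
    have hterm (i : I) (hi : c' i ≠ 0) : 0 < c' i * (h i x - a i) := by
      rcases lt_or_gt_of_ne hi with hlt | hgt
      · have := lt_of_le_of_ne (not_lt.1 (mt (hside i).1 hlt.not_gt)) (hx i)
        exact mul_pos_of_neg_of_neg hlt (sub_neg.2 this)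
      · exact mul_pos hgt (sub_pos.2 ((hside i).2 hgt))
    obtain ⟨j, hj⟩ := hne'
    refine ⟨x, Finset.sum_pos' (fun i _ ↦ ?_) ⟨j, Finset.mem_univ j, hterm j hj⟩⟩
    rcases eq_or_ne (c' i) 0 with hi | hi
    · simp [hi]
    · exact (hterm i hi).le
  obtain ⟨x, hx⟩ := hpos c hne
  obtain ⟨y, hy⟩ := hpos (-c) (by simpa using hne)
  simp only [Pi.neg_apply, neg_mul, Finset.sum_neg_distrib, hsum] at hx hy
  linarith

/-- In a generic arrangement, moving away from a point of the intersection of independent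
hyperplanes realizes all the signs with respect to them, keeping the other signs fixed. -/
lemma exists_forall_mem_signPatterns
    (hgen : ∀ I : Finset (Fin N), IsCentral h a I → rk h I = I.card)
    {I : Finset (Fin N)} (hI : rk h I = I.card) :
    ∃ t : Finset (Fin N), ∀ u : Finset (Fin N), (∀ i ∉ I, i ∈ u ↔ i ∈ t) → u ∈ signPatterns h a := by
  classical
  obtain ⟨x, hx⟩ := (rk_eq_card_iff.1 hI).exists_forall_apply_eq fun i ↦ a i
  let J : Finset (Fin N) := {i | h i x = a i}
  have hIJ : I ⊆ J := fun i hi ↦ by simpa [J] using hx ⟨i, hi⟩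
  have hJ : rk h J = J.card := hgen J ⟨x, by simp [J]⟩
  refine ⟨positiveSide h a x, fun u hu ↦ ?_⟩
  obtain ⟨v, hv⟩ := (rk_eq_card_iff.1 hJ).exists_forall_apply_eq fun i ↦
    if (i : Fin N) ∈ u then 1 else -1
  have hnear : ∀ i, ∀ᶠ ε : ℝ in nhdsWithin 0 (Set.Ioi 0),
      h i (x + ε • v) ≠ a i ∧ (a i < h i (x + ε • v) ↔ i ∈ u) := by
    intro i
    by_cases hi : i ∈ J
    · have hvi := hv ⟨i, hi⟩
      have hxi : h i x = a i := by simpa [J] using hi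
      filter_upwards [self_mem_nhdsWithin] with ε (hε : 0 < ε)
      by_cases hiu : i ∈ u <;> simp_all [hε.ne', hε.le]
    · have hxi : h i x ≠ a i := by simpa [J] using hi
      rw [hu i fun hiI ↦ hi (hIJ hiI), mem_positiveSide]
      have hcont : ContinuousAt (fun ε : ℝ ↦ h i (x + ε • v)) 0 := by
        simp only [map_add, map_smul, smul_eq_mul]
        fun_prop
      refine Filter.Eventually.filter_mono nhdsWithin_le_nhds ?_
      rcases lt_or_gt_of_ne hxi with hlt | hgt
      · filter_upwards [hcont.eventually (gt_mem_nhds (by simpa using hlt))] with ε hε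
        exact ⟨hε.ne, iff_of_false hε.not_gt hlt.not_gt⟩
      · filter_upwards [hcont.eventually (lt_mem_nhds (by simpa using hgt))] with ε hε
        exact ⟨hε.ne', iff_of_true hε hgt⟩
  obtain ⟨ε, hε⟩ := (Filter.eventually_all.2 hnear).exists
  refine mem_signPatterns.2 ⟨x + ε • v, fun i ↦ (hε i).1, ?_⟩
  ext i
  rw [mem_positiveSide, (hε i).2]

end Arrangement


/-- For a generic arrangement (every central subset is independent), the number of
regions equals the number of independent (acyclic) subsets. -/
theorem stmt2 (d N : ℕ) (h : Fin N → ((Fin d → ℝ) →ₗ[ℝ] ℝ)) (hne : ∀ i, h i ≠ 0)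
    (a : Fin N → ℝ)
    (hgen : ∀ I : Finset (Fin N), IsCentral h a I → rk h I = I.card) :
    numRegions {x : Fin d → ℝ | ∀ i, h i x ≠ a i} =
      Nat.card {I : Finset (Fin N) // rk h I = I.card} := by
  classical
  rw [numRegions_eq_card_signPatterns, Nat.card_eq_fintype_card, Fintype.card_subtype]
  apply le_antisymm
  · refine (Finset.card_le_card_shatterer _).trans (Finset.card_le_card fun I hI ↦ ?_)
    simpa [rk_eq_card_iff] using linearIndependent_of_shatters (Finset.mem_shatterer.1 hI)
  · refine card_le_card_of_forall_exists_cube_subset _ _ fun I hI ↦ ?_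
    exact exists_forall_mem_signPatterns hgen (by simpa using hI)
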